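/- Let σ and n be positive integers with σ < n, and write n = mσ + p with 0 ≤ p < σ. Then the maximum, over all strings w of length n over a totally ordered alphabet of size σ, of the total number of Lyndon factors of w (i.e., the number of pairs (i, j) with 1 ≤ i ≤ j ≤ n such that the substring w[i..j] is a Lyndon word) equals C(n+1, 2) − (σ − p)·C(m+1, 2) − p·C(m+2, 2) + n, and this maximum is attained by the string w = a₁^m ⋯ a_{σ−p}^m a_{σ−p+1}^{m+1} ⋯ a_σ^{m+1}. -/

import Mathlib

/-- A nonempty string is a Lyndon word if it is lexicographically strictly smaller
than all of its nonempty proper suffixes. -/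
def IsLyndon {α : Type*} [LinearOrder α] (w : List α) : Prop :=
  w ≠ [] ∧ ∀ i, 0 < i → i < w.length → List.Lex (· < ·) w (w.drop i)

/-- The subsequence of `w` extracted at the set of positions `S` (taken in increasing order). -/
def subseqAt {α : Type*} (w : List α) (S : Finset (Fin w.length)) : List α :=
  (S.sort (· ≤ ·)).map w.get

/-- The total number of occurrences of Lyndon subsequences in `w`: the number of
(nonempty) sets of positions whose extracted word is a Lyndon word. -/
noncomputable def totalLyndonSubseq {α : Type*} [LinearOrder α] (w : List α) : ℕ :=
  Nat.card {S : Finset (Fin w.length) // IsLyndon (subseqAt w S)}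

/-- The string a₁^{k₁} a₂^{k₂} ⋯ a_σ^{k_σ} over the alphabet Fin σ. -/
def blockString (σ : ℕ) (k : Fin σ → ℕ) : List (Fin σ) :=
  (List.finRange σ).flatMap fun c => List.replicate (k c) c

/-- The total number of Lyndon factors of `w`: the number of pairs of positions
(0-based `i < j ≤ |w|`) such that the substring `w[i..j)` is a Lyndon word. -/
noncomputable def totalLyndonFactors {α : Type*} [LinearOrder α] (w : List α) : ℕ :=
  Nat.card {q : ℕ × ℕ // q.1 < q.2 ∧ q.2 ≤ w.length ∧ IsLyndon ((w.take q.2).drop q.1)}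

/-- The pairs `(i, j)` of positions for which the factor from `i` through `j` is Lyndon. -/
noncomputable def lyndonPairs {α : Type*} [LinearOrder α] (w : List α) :
    Finset (Fin w.length × Fin w.length) :=
  open Classical in
  Finset.univ.filter fun q => q.1 ≤ q.2 ∧ IsLyndon ((w.take (q.2 + 1)).drop q.1)

theorem mem_lyndonPairs {α : Type*} [LinearOrder α] {w : List α}
    {q : Fin w.length × Fin w.length} :
    q ∈ lyndonPairs w ↔ q.1 ≤ q.2 ∧ IsLyndon ((w.take (q.2 + 1)).drop q.1) := by
  simp [lyndonPairs]

theorem totalLyndonFactors_eq_card_lyndonPairs {α : Type*} [LinearOrder α] (w : List α) :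
    totalLyndonFactors w = (lyndonPairs w).card := by
  rw [totalLyndonFactors, ← Nat.card_eq_finsetCard]
  refine (Nat.card_congr (Equiv.ofBijective (fun q => ⟨(q.1.1, q.1.2 + 1),
    Nat.lt_succ_of_le (mem_lyndonPairs.1 q.2).1, q.1.2.2, (mem_lyndonPairs.1 q.2).2⟩)
    ⟨?_, ?_⟩)).symm
  · rintro ⟨⟨i, j⟩, h⟩ ⟨⟨i', j'⟩, h'⟩ e
    simpa [Fin.ext_iff] using e
  · rintro ⟨⟨i, j⟩, hij, hj, hl⟩
    simp only at hij hj hl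
    obtain ⟨j, rfl⟩ : ∃ k, j = k + 1 := ⟨j - 1, by omega⟩
    exact ⟨⟨(⟨i, by omega⟩, ⟨j, by omega⟩),
      mem_lyndonPairs.2 ⟨by simpa [Fin.le_def] using Nat.le_of_lt_succ hij, hl⟩⟩, rfl⟩

/-- The pairs of positions, in either order, carrying letters in strictly increasing order. -/
def ascendingPairs {α : Type*} [LinearOrder α] (w : List α) :
    Finset (Fin w.length × Fin w.length) :=
  Finset.univ.filter fun q => w.get q.1 < w.get q.2

theorem IsLyndon.head_lt_getLast {α : Type*} [LinearOrder α] {u : List α} (h : IsLyndon u)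
    (hu : 1 < u.length) : u[0] < u[u.length - 1] := by
  have h1 := h.2 (u.length - 1) (by omega) (by omega)
  rw [List.drop_length_sub_one (by grind)] at h1
  match u, hu with
  | a :: b :: t, _ =>
    simp only [List.getLast_eq_getElem] at h1
    generalize (a :: b :: t)[(a :: b :: t).length - 1] = x at h1 ⊢
    cases h1 with
    | cons h => cases h
    | rel h => exact h

theorem lex_replicate_append_cons {α : Type*} [LinearOrder α] {a b : α} (hab : a < b)
    (t s : List α) {j k : ℕ} (hjk : j < k) :
    List.Lex (· < ·) (List.replicate k a ++ s) (List.replicate j a ++ b :: t) := by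
  induction j generalizing k with
  | zero =>
    obtain ⟨k, rfl⟩ : ∃ l, k = l + 1 := ⟨k - 1, by omega⟩
    exact List.Lex.rel hab
  | succ j ih =>
    obtain ⟨k, rfl⟩ : ∃ l, k = l + 1 := ⟨k - 1, by omega⟩
    exact List.Lex.cons (ih (by omega))

theorem exists_replicate_append_cons {α : Type*} [LinearOrder α] {a : α} {t : List α}
    (hs : (a :: t).Pairwise (· ≤ ·)) (hlt : ∃ x ∈ t, a < x) :
    ∃ k b s, a < b ∧ a :: t = List.replicate (k + 1) a ++ b :: s := by
  induction t with
  | nil => simp at hlt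
  | cons b t ih =>
    rcases (List.rel_of_pairwise_cons hs List.mem_cons_self).lt_or_eq with hab | rfl
    · exact ⟨0, b, t, hab, rfl⟩
    · obtain ⟨x, hx, hax⟩ := hlt
      obtain ⟨k, c, s, hc, e⟩ := ih hs.of_cons
        ⟨x, (List.mem_cons.1 hx).resolve_left hax.ne', hax⟩
      exact ⟨k + 1, c, s, hc, by rw [e]; rfl⟩

theorem isLyndon_of_pairwise_le {α : Type*} [LinearOrder α] {u : List α}
    (hs : u.Pairwise (· ≤ ·)) (hu : 1 < u.length) (hlt : u[0] < u[u.length - 1]) :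
    IsLyndon u := by
  match u, hu with
  | a :: c :: t, _ =>
    obtain ⟨k, b, s, hab, e⟩ := exists_replicate_append_cons hs
      ⟨_, List.getElem_mem (l := c :: t) (n := t.length) (by simp), by simpa using hlt⟩
    refine ⟨by simp, fun i hi hil => ?_⟩
    rw [e] at hs hil ⊢
    rcases Nat.lt_or_ge i (k + 2) with hik | hik
    · have hd : (List.replicate (k + 1) a ++ b :: s).drop i
          = List.replicate (k + 1 - i) a ++ b :: s := by
        rw [List.drop_append_of_le_length (by simp; omega), List.drop_replicate]
      rw [hd]
      exact lex_replicate_append_cons hab _ _ (by omega)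
    · have hb : ∀ x ∈ s, b ≤ x := fun x hx =>
        List.rel_of_pairwise_cons (List.pairwise_append.1 hs).2.1 hx
      rw [List.drop_eq_getElem_cons hil]
      refine List.Lex.rel (hab.trans_le (hb _ ?_))
      obtain ⟨l, rfl⟩ : ∃ l, i = k + 1 + (l + 1) := ⟨i - (k + 2), by omega⟩
      simp [List.getElem_append_right]

theorem isLyndon_singleton {α : Type*} [LinearOrder α] (a : α) : IsLyndon [a] :=
  ⟨by simp, fun i hi hil => by simp at hil; omega⟩

theorem getElem_zero_drop_take {α : Type*} (w : List α) (i j : Fin w.length) (hij : i ≤ j) :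
    ((w.take (j + 1)).drop i)[0]'(by have := j.2; have : (i : ℕ) ≤ j := hij; simp; omega)
      = w.get i := by
  simp

theorem getElem_last_drop_take {α : Type*} (w : List α) (i j : Fin w.length) (hij : i ≤ j) :
    ((w.take (j + 1)).drop i)[((w.take (j + 1)).drop i).length - 1]'(by
      have := j.2; have : (i : ℕ) ≤ j := hij; simp; omega) = w.get j := by
  have := j.2
  have : (i : ℕ) ≤ j := hij
  simp only [List.getElem_drop, List.getElem_take, List.get_eq_getElem]
  congr 1
  simp
  omega

theorem disjoint_diag_ascendingPairs {α : Type*} [LinearOrder α] (w : List α) :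
    Disjoint (Finset.univ : Finset (Fin w.length)).diag (ascendingPairs w) := by
  rw [Finset.disjoint_left]
  rintro ⟨i, j⟩ h h'
  simp only [Finset.mem_diag, Finset.mem_univ, true_and] at h
  simp [ascendingPairs, h] at h'

theorem lyndonPairs_subset {α : Type*} [LinearOrder α] (w : List α) :
    lyndonPairs w ⊆ Finset.univ.diag ∪ ascendingPairs w := by
  rintro ⟨i, j⟩ h
  obtain ⟨hij, hl⟩ := mem_lyndonPairs.1 h
  simp only at hij hl
  simp only [Finset.mem_union, Finset.mem_diag, Finset.mem_univ, true_and, ascendingPairs,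
    Finset.mem_filter]
  rcases hij.eq_or_lt with rfl | hlt
  · exact Or.inl rfl
  · right
    have := hl.head_lt_getLast (by have := j.2; have : (i : ℕ) < j := hlt; simp; omega)
    rwa [getElem_zero_drop_take w i j hij, getElem_last_drop_take w i j hij] at this

theorem lyndonPairs_eq_of_pairwise_le {α : Type*} [LinearOrder α] {w : List α}
    (hs : w.Pairwise (· ≤ ·)) : lyndonPairs w = Finset.univ.diag ∪ ascendingPairs w := by
  refine (lyndonPairs_subset w).antisymm ?_
  rintro ⟨i, j⟩ h
  simp only [Finset.mem_union, Finset.mem_diag, Finset.mem_univ, true_and, ascendingPairs,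
    Finset.mem_filter] at h
  rw [mem_lyndonPairs]
  rcases h with rfl | h
  · refine ⟨le_rfl, ?_⟩
    have e : (w.take (i + 1)).drop i = [w.get i] := by
      rw [List.drop_take, Nat.add_sub_cancel_left, List.drop_eq_getElem_cons i.2]
      rfl
    simp only [e]
    exact isLyndon_singleton _
  · have hij : i < j := by
      by_contra! hji
      rcases hji.eq_or_lt with rfl | hji
      · exact lt_irrefl _ h
      · exact absurd h (List.pairwise_iff_get.1 hs _ _ hji).not_gt
    refine ⟨hij.le, isLyndon_of_pairwise_le ((hs.sublist (List.take_sublist _ _)).sublist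
      (List.drop_sublist _ _)) (by have := j.2; have : (i : ℕ) < j := hij; simp; omega) ?_⟩
    rwa [getElem_zero_drop_take w i j hij.le, getElem_last_drop_take w i j hij.le]

theorem totalLyndonFactors_le {α : Type*} [LinearOrder α] (w : List α) :
    totalLyndonFactors w ≤ w.length + (ascendingPairs w).card := by
  rw [totalLyndonFactors_eq_card_lyndonPairs]
  refine (Finset.card_le_card (lyndonPairs_subset w)).trans ?_
  simp [Finset.card_union_of_disjoint (disjoint_diag_ascendingPairs w)]

theorem totalLyndonFactors_eq_of_pairwise_le {α : Type*} [LinearOrder α] {w : List α}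
    (hs : w.Pairwise (· ≤ ·)) :
    totalLyndonFactors w = w.length + (ascendingPairs w).card := by
  rw [totalLyndonFactors_eq_card_lyndonPairs, lyndonPairs_eq_of_pairwise_le hs]
  simp [Finset.card_union_of_disjoint (disjoint_diag_ascendingPairs w)]

theorem card_filter_get_eq {α : Type*} [DecidableEq α] (w : List α) (c : α) :
    (Finset.univ.filter fun i => w.get i = c).card = w.count c := by
  rw [Finset.card_filter]
  simp only [List.get_eq_getElem]
  rw [Fin.sum_univ_fun_getElem w fun x => if x = c then 1 else 0]
  induction w with
  | nil => rfl
  | cons a t ih => rw [List.map_cons, List.sum_cons, ih, List.count_cons, add_comm]; simp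

theorem card_ascendingPairs {α : Type*} [LinearOrder α] [Fintype α] (w : List α) :
    2 * (ascendingPairs w).card + ∑ c, w.count c ^ 2 = w.length ^ 2 := by
  have heq : (Finset.univ.filter fun q : Fin w.length × Fin w.length =>
      w.get q.1 = w.get q.2).card = ∑ c, w.count c ^ 2 := by
    rw [Finset.card_eq_sum_card_fiberwise (f := fun q => w.get q.1) (t := Finset.univ)
      (fun _ _ => Finset.mem_coe.2 (Finset.mem_univ _))]
    refine Finset.sum_congr rfl fun c _ => ?_
    rw [← card_filter_get_eq, sq, ← Finset.card_product]
    congr 1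
    ext ⟨i, j⟩
    simp only [Finset.mem_filter, Finset.mem_univ, true_and, Finset.mem_product]
    grind
  have hgt : (Finset.univ.filter fun q : Fin w.length × Fin w.length =>
      w.get q.2 < w.get q.1).card = (ascendingPairs w).card :=
    Finset.card_equiv (Equiv.prodComm _ _) (by simp [ascendingPairs])
  have hle : (Finset.univ.filter fun q : Fin w.length × Fin w.length =>
      ¬ w.get q.1 < w.get q.2).card = ∑ c, w.count c ^ 2 + (ascendingPairs w).card := by
    rw [← heq, ← hgt, ← Finset.card_union_of_disjoint]
    · congr 1
      ext q
      simp only [Finset.mem_filter, Finset.mem_univ, true_and, Finset.mem_union, not_lt,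
        le_iff_lt_or_eq]
      grind
    · rw [Finset.disjoint_filter]
      intro q _ h
      exact h.not_gt
  have htot := Finset.card_filter_add_card_filter_not (s := Finset.univ)
    (fun q : Fin w.length × Fin w.length => w.get q.1 < w.get q.2)
  rw [hle, Finset.card_univ, Fintype.card_prod, Fintype.card_fin] at htot
  rw [ascendingPairs] at *
  linarith

theorem sum_count_eq_length {α : Type*} [DecidableEq α] [Fintype α] (w : List α) :
    ∑ c, w.count c = w.length := by
  simpa using Multiset.sum_count_eq_card (s := Finset.univ) (m := (w : Multiset α)) (by simp)

theorem blockString_pairwise_le (σ : ℕ) (k : Fin σ → ℕ) :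
    (blockString σ k).Pairwise (· ≤ ·) := by
  rw [blockString, List.pairwise_flatMap]
  refine ⟨fun c _ => ?_, (List.pairwise_lt_finRange σ).imp ?_⟩
  · simp [List.pairwise_replicate]
  · intro a b hab x hx y hy
    rw [List.eq_of_mem_replicate hx, List.eq_of_mem_replicate hy]
    exact hab.le

theorem count_blockString (σ : ℕ) (k : Fin σ → ℕ) (c : Fin σ) :
    (blockString σ k).count c = k c := by
  rw [blockString, List.count_flatMap]
  simp [Function.comp_def, List.count_replicate, ← Fin.sum_univ_def]

theorem length_blockString (σ : ℕ) (k : Fin σ → ℕ) : (blockString σ k).length = ∑ c, k c := by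
  simp only [← sum_count_eq_length, count_blockString]

/-- Sums over `Fin σ` of a quantity taking one value below `σ - p` and another from there on. -/
theorem sum_ite_lt_sub {σ p : ℕ} (hp : p ≤ σ) (x y : ℕ) :
    ∑ c : Fin σ, (if (c : ℕ) < σ - p then x else y) = (σ - p) * x + p * y := by
  rw [Fin.sum_univ_eq_sum_range (fun c => if c < σ - p then x else y)]
  obtain ⟨q, rfl⟩ := Nat.exists_eq_add_of_le' hp
  rw [Nat.add_sub_cancel, Finset.sum_range_add]
  rw [Finset.sum_congr rfl fun c hc => if_pos (Finset.mem_range.1 hc)]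
  simp

theorem two_mul_choose_succ_two (n : ℕ) : 2 * (n + 1).choose 2 = n * (n + 1) := by
  rw [Nat.choose_two_right, Nat.mul_div_cancel' (Nat.even_mul_pred_self (n + 1)).two_dvd,
    Nat.add_sub_cancel, mul_comm]

theorem le_sum_sq {σ m p : ℕ} (hp : p ≤ σ) (k : Fin σ → ℕ) (hk : ∑ c, k c = m * σ + p) :
    (σ - p) * m ^ 2 + p * (m + 1) ^ 2 ≤ ∑ c, k c ^ 2 := by
  have h : ∀ c, (2 * m + 1) * k c ≤ k c ^ 2 + m * (m + 1) := fun c => by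
    rcases Nat.lt_or_ge m (k c) with h | h
    · obtain ⟨d, hd⟩ := Nat.exists_eq_add_of_lt h
      rw [hd]; nlinarith [Nat.zero_le (d * d)]
    · obtain ⟨d, hd⟩ := Nat.exists_eq_add_of_le h
      rw [hd]; nlinarith [Nat.zero_le (d * d)]
  have := Finset.sum_le_sum fun c (_ : c ∈ Finset.univ) => h c
  rw [← Finset.mul_sum, Finset.sum_add_distrib, hk] at this
  simp only [Finset.sum_const, Finset.card_univ, Fintype.card_fin, smul_eq_mul] at this
  obtain ⟨q, rfl⟩ := Nat.exists_eq_add_of_le' hp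
  rw [Nat.add_sub_cancel]
  nlinarith

theorem two_mul_balanced_bound {σ n m p : ℕ} (hn : n = m * σ + p) (hp : p ≤ σ) :
    2 * ((n + 1).choose 2 - (σ - p) * (m + 1).choose 2 - p * (m + 2).choose 2)
      = n ^ 2 - ((σ - p) * m ^ 2 + p * (m + 1) ^ 2) := by
  have h1 := two_mul_choose_succ_two n
  have h2 : 2 * ((σ - p) * (m + 1).choose 2) = (σ - p) * (m * (m + 1)) := by
    rw [← two_mul_choose_succ_two]; ring
  have h3 : 2 * (p * (m + 2).choose 2) = p * ((m + 1) * (m + 2)) := by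
    rw [← two_mul_choose_succ_two (m + 1)]; ring
  rw [Nat.mul_sub, Nat.mul_sub, h1, h2, h3]
  obtain ⟨q, rfl⟩ := Nat.exists_eq_add_of_le' hp
  rw [Nat.add_sub_cancel]
  have e1 : n * (n + 1) = n ^ 2 + n := by ring
  have e2 : q * (m * (m + 1)) + p * ((m + 1) * (m + 2))
      = (q * m ^ 2 + p * (m + 1) ^ 2) + n := by rw [hn]; ring
  omega

theorem totalLyndonFactors_blockString_balanced {σ n m p : ℕ} (hn : n = m * σ + p)
    (hp : p ≤ σ) :
    (blockString σ fun c => if (c : ℕ) < σ - p then m else m + 1).length = n ∧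
    totalLyndonFactors (blockString σ fun c => if (c : ℕ) < σ - p then m else m + 1)
      = (n + 1).choose 2 - (σ - p) * (m + 1).choose 2 - p * (m + 2).choose 2 + n := by
  have hlen : (blockString σ fun c => if (c : ℕ) < σ - p then m else m + 1).length = n := by
    rw [length_blockString, sum_ite_lt_sub hp, hn]
    obtain ⟨q, rfl⟩ := Nat.exists_eq_add_of_le' hp
    rw [Nat.add_sub_cancel]
    ring
  refine ⟨hlen, ?_⟩
  have hcard := card_ascendingPairs (blockString σ fun c => if (c : ℕ) < σ - p then m else m + 1)
  simp only [count_blockString, hlen, ite_pow, sum_ite_lt_sub hp] at hcard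
  rw [totalLyndonFactors_eq_of_pairwise_le (blockString_pairwise_le _ _)]
  have := two_mul_balanced_bound hn hp
  omega

theorem maximum_total_lyndon_factors (σ n m p : ℕ) (hσ : 0 < σ) (hσn : σ < n)
    (hn : n = m * σ + p) (hp : p < σ) :
    IsGreatest {k | ∃ w : List (Fin σ), w.length = n ∧ totalLyndonFactors w = k}
      ((n + 1).choose 2 - (σ - p) * (m + 1).choose 2 - p * (m + 2).choose 2 + n) ∧
    totalLyndonFactors (blockString σ fun c => if (c : ℕ) < σ - p then m else m + 1)
      = (n + 1).choose 2 - (σ - p) * (m + 1).choose 2 - p * (m + 2).choose 2 + n := by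
  have hblock := totalLyndonFactors_blockString_balanced hn hp.le
  refine ⟨⟨⟨_, hblock⟩, ?_⟩, hblock.2⟩
  rintro _ ⟨w, hw, rfl⟩
  have hle := totalLyndonFactors_le w
  have hcard := card_ascendingPairs w
  have hsq := le_sum_sq hp.le (fun c => w.count c) (by rw [sum_count_eq_length, hw, hn])
  have hbound := two_mul_balanced_bound hn hp.le
  simp only [hw] at hcard
  omega
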